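/- For every dilation δ of an affine plane, the map α_δ : Tr → Tr defined by α_δ(σ) = δ⁻¹ ∘ σ ∘ δ for every translation σ is a trace-preserving endomorphism of the translation group Tr. -/

import Mathlib

/-- An affine plane: a type `P` of points together with a set of subsets of `P`
(the lines) satisfying the three axioms of affine planes. -/
structure AffinePlane (P : Type*) where
  lines : Set (Set P)
  /-- A1: any two distinct points lie on exactly one line. -/
  a1 : ∀ A B : P, A ≠ B → ∃! ℓ : Set P, ℓ ∈ lines ∧ A ∈ ℓ ∧ B ∈ ℓ
  /-- A2: for a point `A` not on a line `ℓ` there is exactly one line through `A`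
  disjoint from `ℓ`. -/
  a2 : ∀ (A : P) (ℓ : Set P), ℓ ∈ lines → A ∉ ℓ →
    ∃! m : Set P, m ∈ lines ∧ A ∈ m ∧ m ∩ ℓ = ∅
  /-- A3: there are three points not all on one line. -/
  a3 : ∃ A B C : P, ∀ ℓ ∈ lines, ¬(A ∈ ℓ ∧ B ∈ ℓ ∧ C ∈ ℓ)

namespace AffinePlane

variable {P : Type*}

/-- Two lines are parallel if they are equal or disjoint. -/
def Parallel (π : AffinePlane P) (ℓ m : Set P) : Prop :=
  ℓ = m ∨ ℓ ∩ m = ∅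

/-- A collineation is a bijection of the points mapping lines to lines. -/
def IsCollineation (π : AffinePlane P) (f : P ≃ P) : Prop :=
  ∀ ℓ ∈ π.lines, f '' ℓ ∈ π.lines

/-- A dilation is a collineation `f` such that for all distinct points `A`, `B`,
the line through `f A` and `f B` is parallel to the line through `A` and `B`. -/
def IsDilation (π : AffinePlane P) (f : P ≃ P) : Prop :=
  IsCollineation π f ∧
  ∀ A B : P, A ≠ B → ∀ ℓ m : Set P,
    (ℓ ∈ π.lines ∧ f A ∈ ℓ ∧ f B ∈ ℓ) →
    (m ∈ π.lines ∧ A ∈ m ∧ B ∈ m) →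
    Parallel π ℓ m

/-- A translation is a dilation which is the identity or has no fixed point. -/
def IsTranslation (π : AffinePlane P) (f : P ≃ P) : Prop :=
  IsDilation π f ∧ (f = Equiv.refl P ∨ ∀ A : P, f A ≠ A)

/-- An endomorphism of the translation group `Tr` of the affine plane `π`,
viewed as a map on bijections: it sends translations to translations and
satisfies `α (σ ∘ τ) = α σ ∘ α τ` on translations (here `τ.trans σ` is the
composite `σ ∘ τ`, applying `τ` first). -/
def IsEndo (π : AffinePlane P) (α : (P ≃ P) → (P ≃ P)) : Prop :=
  (∀ σ : P ≃ P, IsTranslation π σ → IsTranslation π (α σ)) ∧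
  (∀ σ τ : P ≃ P, IsTranslation π σ → IsTranslation π τ →
    α (τ.trans σ) = (α τ).trans (α σ))

/-- A trace-preserving endomorphism of the translation group: an endomorphism
`α` such that for every translation `σ` with `α σ ≠ id` and every point `A`,
the point `α σ A` lies on (any, hence the unique) line through `A` and `σ A`. -/
def IsTracePreserving (π : AffinePlane P) (α : (P ≃ P) → (P ≃ P)) : Prop :=
  IsEndo π α ∧
  ∀ σ : P ≃ P, IsTranslation π σ → α σ ≠ Equiv.refl P →
    ∀ (A : P) (ℓ : Set P), ℓ ∈ π.lines → A ∈ ℓ → σ A ∈ ℓ → (α σ) A ∈ ℓ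

/-- Pointwise sum of two maps: `(α + β) σ = α σ ∘ β σ` (apply `β σ` first). -/
def addE (α β : (P ≃ P) → (P ≃ P)) : (P ≃ P) → (P ≃ P) :=
  fun σ => (β σ).trans (α σ)

/-- Composite of two maps: `(α ∘ β) σ = α (β σ)`. -/
def compE (α β : (P ≃ P) → (P ≃ P)) : (P ≃ P) → (P ≃ P) :=
  fun σ => α (β σ)

/-- The zero endomorphism, sending every translation to the identity. -/
def zeroE : (P ≃ P) → (P ≃ P) := fun _ => Equiv.refl P

/-- The identity endomorphism, sending every translation to itself. -/
def oneE : (P ≃ P) → (P ≃ P) := fun σ => σ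

/-- Negation: `(-α) σ = (α σ)⁻¹`. -/
def negE (α : (P ≃ P) → (P ≃ P)) : (P ≃ P) → (P ≃ P) :=
  fun σ => (α σ).symm

/-- `α` is different from the zero endomorphism (as a map on translations). -/
def NonzeroE (π : AffinePlane P) (α : (P ≃ P) → (P ≃ P)) : Prop :=
  ∃ σ : P ≃ P, IsTranslation π σ ∧ α σ ≠ Equiv.refl P

theorem Parallel.symm {π : AffinePlane P} {ℓ m : Set P} (h : Parallel π ℓ m) :
    Parallel π m ℓ :=
  h.imp Eq.symm fun h => by rwa [Set.inter_comm]

theorem Parallel.eq_of_mem {π : AffinePlane P} {ℓ m : Set P} (h : Parallel π ℓ m) {A : P}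
    (hl : A ∈ ℓ) (hm : A ∈ m) : ℓ = m :=
  h.resolve_right fun h => (h ▸ (⟨hl, hm⟩ : A ∈ ℓ ∩ m) : A ∈ (∅ : Set P))

theorem eq_of_two_mem (π : AffinePlane P) {ℓ m : Set P} (hℓ : ℓ ∈ π.lines) (hm : m ∈ π.lines)
    {A B : P} (hAB : A ≠ B) (hAℓ : A ∈ ℓ) (hBℓ : B ∈ ℓ) (hAm : A ∈ m) (hBm : B ∈ m) :
    ℓ = m :=
  (π.a1 A B hAB).unique ⟨hℓ, hAℓ, hBℓ⟩ ⟨hm, hAm, hBm⟩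

theorem Parallel.trans {π : AffinePlane P} {ℓ m n : Set P} (hℓ : ℓ ∈ π.lines)
    (hm : m ∈ π.lines) (hn : n ∈ π.lines) (hℓm : Parallel π ℓ m) (hmn : Parallel π m n) :
    Parallel π ℓ n := by
  rcases Set.eq_empty_or_nonempty (ℓ ∩ n) with h | ⟨A, hAℓ, hAn⟩
  · exact Or.inr h
  by_cases hAm : A ∈ m
  · exact Or.inl ((hℓm.eq_of_mem hAℓ hAm).trans (hmn.eq_of_mem hAm hAn))
  · exact Or.inl ((π.a2 A m hm hAm).unique
      ⟨hℓ, hAℓ, hℓm.resolve_left fun h => hAm (h ▸ hAℓ)⟩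
      ⟨hn, hAn, hmn.symm.resolve_left fun h => hAm (h ▸ hAn)⟩)

/-- As soon as there is a line, there are lines through every point. -/
theorem exists_line_through (π : AffinePlane P) {ℓ : Set P} (hℓ : ℓ ∈ π.lines) (A : P) :
    ∃ m ∈ π.lines, A ∈ m := by
  by_cases hA : A ∈ ℓ
  · exact ⟨ℓ, hℓ, hA⟩
  · obtain ⟨m, ⟨hm, hAm, -⟩, -⟩ := π.a2 A ℓ hℓ hA
    exact ⟨m, hm, hAm⟩

theorem exists_line_through_pair (π : AffinePlane P) {ℓ : Set P} (hℓ : ℓ ∈ π.lines) (A B : P) :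
    ∃ m ∈ π.lines, A ∈ m ∧ B ∈ m := by
  by_cases h : A = B
  · obtain ⟨m, hm, hA⟩ := π.exists_line_through hℓ A
    exact ⟨m, hm, hA, h ▸ hA⟩
  · exact (π.a1 A B h).exists

/-- Every point is a vertex of a triangle, provided there is at least one line. -/
theorem exists_triangle (π : AffinePlane P) {ℓ : Set P} (hℓ : ℓ ∈ π.lines) (A : P) :
    ∃ B C : P, ∀ m ∈ π.lines, ¬(A ∈ m ∧ B ∈ m ∧ C ∈ m) := by
  obtain ⟨X, Y, Z, hXYZ⟩ := π.a3
  by_cases hAY : A = Y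
  · subst hAY
    exact ⟨X, Z, fun m hm h => hXYZ m hm ⟨h.2.1, h.1, h.2.2⟩⟩
  obtain ⟨n, hn, hYn, hZn⟩ := π.exists_line_through_pair hℓ Y Z
  by_cases hAn : A ∈ n
  · refine ⟨X, Y, fun m hm h => hXYZ n hn ⟨?_, hYn, hZn⟩⟩
    exact π.eq_of_two_mem hm hn hAY h.1 h.2.2 hAn hYn ▸ h.2.1
  · refine ⟨Y, Z, fun m hm h => hAn ?_⟩
    have hYZ : Y ≠ Z := by
      rintro rfl
      obtain ⟨k, hk, hXk, hYk⟩ := π.exists_line_through_pair hℓ X Y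
      exact hXYZ k hk ⟨hXk, hYk, hYk⟩
    exact π.eq_of_two_mem hm hn hYZ h.2.1 h.2.2 hYn hZn ▸ h.1

theorem line_nonempty (π : AffinePlane P) {ℓ : Set P} (hℓ : ℓ ∈ π.lines) : ℓ.Nonempty := by
  rw [Set.nonempty_iff_ne_empty]
  rintro rfl
  obtain ⟨X, Y, Z, hXYZ⟩ := π.a3
  obtain ⟨m, hm, hXm, hYm⟩ := π.exists_line_through_pair hℓ X Y
  obtain ⟨n, hn, hXn, hZn⟩ := π.exists_line_through_pair hℓ X Z
  have hmn : m = n := (π.a2 X ∅ hℓ (Set.notMem_empty X)).unique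
    ⟨hm, hXm, Set.inter_empty m⟩ ⟨hn, hXn, Set.inter_empty n⟩
  exact hXYZ m hm ⟨hXm, hYm, hmn ▸ hZn⟩

theorem line_nontrivial (π : AffinePlane P) {ℓ : Set P} (hℓ : ℓ ∈ π.lines) : ℓ.Nontrivial := by
  obtain ⟨A, hA⟩ := π.line_nonempty hℓ
  by_contra hnt
  have hsub := Set.not_nontrivial_iff.1 hnt
  have hdisj : ∀ m : Set P, A ∉ m → m ∩ ℓ = ∅ := fun m hAm =>
    Set.eq_empty_of_forall_notMem fun x hx => hAm (hsub hx.2 hA ▸ hx.1)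
  obtain ⟨B, C, hABC⟩ := π.exists_triangle hℓ A
  obtain ⟨m, hm, hAm, hBm⟩ := π.exists_line_through_pair hℓ A B
  obtain ⟨n, hn, hBn, hCn⟩ := π.exists_line_through_pair hℓ B C
  have hCm : C ∉ m := fun h => hABC m hm ⟨hAm, hBm, h⟩
  have hAn : A ∉ n := fun h => hABC n hn ⟨h, hBn, hCn⟩
  obtain ⟨k, ⟨hk, hCk, hkm⟩, -⟩ := π.a2 C m hm hCm
  have hAk : A ∉ k := fun h => Set.eq_empty_iff_forall_notMem.1 hkm A ⟨h, hAm⟩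
  have hCℓ : C ∉ ℓ := fun h => hAn (hsub h hA ▸ hCn)
  have hkn : k = n := (π.a2 C ℓ hℓ hCℓ).unique ⟨hk, hCk, hdisj k hAk⟩ ⟨hn, hCn, hdisj n hAn⟩
  exact Set.eq_empty_iff_forall_notMem.1 hkm B ⟨hkn ▸ hBn, hBm⟩

/-- A dilation is a bijection that maps every line to a parallel line. -/
theorem isDilation_iff (π : AffinePlane P) (f : P ≃ P) :
    IsDilation π f ↔ ∀ ℓ ∈ π.lines, f '' ℓ ∈ π.lines ∧ Parallel π (f '' ℓ) ℓ := by
  constructor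
  · rintro ⟨hf, hpar⟩ ℓ hℓ
    obtain ⟨A, hA, B, hB, hAB⟩ := π.line_nontrivial hℓ
    exact ⟨hf ℓ hℓ, hpar A B hAB _ _
      ⟨hf ℓ hℓ, Set.mem_image_of_mem f hA, Set.mem_image_of_mem f hB⟩ ⟨hℓ, hA, hB⟩⟩
  · refine fun h => ⟨fun ℓ hℓ => (h ℓ hℓ).1, ?_⟩
    rintro A B hAB ℓ m ⟨hℓ, hAℓ, hBℓ⟩ ⟨hm, hAm, hBm⟩
    rw [π.eq_of_two_mem hℓ (h m hm).1 (f.injective.ne hAB) hAℓ hBℓ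
      (Set.mem_image_of_mem f hAm) (Set.mem_image_of_mem f hBm)]
    exact (h m hm).2

theorem IsDilation.trans {π : AffinePlane P} {f g : P ≃ P} (hf : IsDilation π f)
    (hg : IsDilation π g) : IsDilation π (f.trans g) := by
  rw [isDilation_iff] at *
  intro ℓ hℓ
  have himage : f.trans g '' ℓ = g '' (f '' ℓ) := by
    rw [Set.image_image]
    rfl
  obtain ⟨hfℓ, hfpar⟩ := hf ℓ hℓ
  obtain ⟨hgℓ, hgpar⟩ := hg _ hfℓ
  rw [himage]
  exact ⟨hgℓ, hgpar.trans hgℓ hfℓ hℓ hfpar⟩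

theorem IsDilation.symm {π : AffinePlane P} {f : P ≃ P} (hf : IsDilation π f) :
    IsDilation π f.symm := by
  rw [isDilation_iff] at *
  intro ℓ hℓ
  obtain ⟨A, hA, B, hB, hAB⟩ := π.line_nontrivial hℓ
  obtain ⟨m, hm, hAm, hBm⟩ := (π.a1 _ _ (f.symm.injective.ne hAB)).exists
  obtain ⟨hfm, hpar⟩ := hf m hm
  have himage : f '' m = ℓ := π.eq_of_two_mem hfm hℓ hAB
    ⟨_, hAm, f.apply_symm_apply A⟩ ⟨_, hBm, f.apply_symm_apply B⟩ hA hB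
  subst himage
  rw [Equiv.symm_image_image]
  exact ⟨hm, hpar.symm⟩

/-- A dilation maps the line through a point and its image into itself. -/
theorem IsDilation.apply_mem {π : AffinePlane P} {f : P ≃ P} (hf : IsDilation π f)
    {ℓ : Set P} (hℓ : ℓ ∈ π.lines) {A B : P} (hA : A ∈ ℓ) (hfA : f A ∈ ℓ) (hB : B ∈ ℓ) :
    f B ∈ ℓ :=
  (((isDilation_iff π f).1 hf ℓ hℓ).2.eq_of_mem (Set.mem_image_of_mem f hA) hfA) ▸
    Set.mem_image_of_mem f hB

/-- Any two traces of a fixed-point-free dilation are parallel. -/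
theorem IsDilation.traces_parallel {π : AffinePlane P} {f : P ≃ P} (hf : IsDilation π f)
    (hfix : ∀ A, f A ≠ A) {ℓ m : Set P} (hℓ : ℓ ∈ π.lines) (hm : m ∈ π.lines) {A B : P}
    (hA : A ∈ ℓ) (hfA : f A ∈ ℓ) (hB : B ∈ m) (hfB : f B ∈ m) : Parallel π ℓ m := by
  rcases Set.eq_empty_or_nonempty (ℓ ∩ m) with h | ⟨Q, hQℓ, hQm⟩
  · exact Or.inr h
  · exact Or.inl (π.eq_of_two_mem hℓ hm (hfix Q) (hf.apply_mem hℓ hA hfA hQℓ) hQℓ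
      (hf.apply_mem hm hB hfB hQm) hQm)

theorem IsTranslation.conj {π : AffinePlane P} {σ δ : P ≃ P} (hσ : IsTranslation π σ)
    (hδ : IsDilation π δ) : IsTranslation π ((δ.trans σ).trans δ.symm) := by
  refine ⟨(hδ.trans hσ.1).trans hδ.symm, hσ.2.imp ?_ fun h A hA => h (δ A) ?_⟩
  · rintro rfl
    simp
  · simpa [Equiv.symm_apply_eq] using hA

/-- For every dilation `δ`, the map `α_δ σ = δ⁻¹ ∘ σ ∘ δ` is a trace-preserving
endomorphism of the translation group. -/
theorem conjugation_isTracePreserving (π : AffinePlane P)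
    (δ : P ≃ P) (hδ : IsDilation π δ) :
    IsTracePreserving π (fun σ : P ≃ P => (δ.trans σ).trans δ.symm) := by
  refine ⟨⟨fun σ hσ => hσ.conj hδ, fun σ τ _ _ => by ext A; simp⟩, ?_⟩
  intro σ hσ hne A ℓ hℓ hA hσA
  have hfix : ∀ B, σ B ≠ B := hσ.2.resolve_left <| by
    rintro rfl
    exact hne (by simp)
  obtain ⟨m, hm, hB, hσB⟩ := (π.a1 _ _ (hfix (δ A)).symm).exists
  obtain ⟨hn, hnm⟩ := (isDilation_iff π δ.symm).1 hδ.symm m hm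
  have hnℓ : Parallel π (δ.symm '' m) ℓ :=
    hnm.trans hn hm hℓ (hσ.1.traces_parallel hfix hm hℓ hB hσB hA hσA)
  exact hnℓ.eq_of_mem ⟨δ A, hB, δ.symm_apply_apply A⟩ hA ▸ Set.mem_image_of_mem δ.symm hσB

end AffinePlane
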